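/- arXiv:1009.1208 — 8 statements merged into one kernel-verified Lean document; each statement's English description precedes it below -/
import Mathlib

section
/- Let f : (Fin n → Bool) → Bool be 0-separating of degree 2. Then for every assignment I with f I = false, the dual assignment satisfies f Ī = true. Consequently, if n ≥ 1, the number of satisfying assignments of f is at least 2^(n-1). -/
/-- If `f` is 0-separating of degree 2, then for every assignment `I`
with `f I = false` the dual assignment satisfies `f`, and consequently (for `n ≥ 1`)
`f` has at least `2^(n-1)` satisfying assignments. -/
theorem stmt_1 (n : ℕ) (f : (Fin n → Bool) → Bool)
    (hsep : ∀ A : Finset (Fin n → Bool), A.card ≤ 2 → (∀ a ∈ A, f a = false) →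
      ∃ i : Fin n, ∀ a ∈ A, a i = false) :
    (∀ I : Fin n → Bool, f I = false → f (fun i => !(I i)) = true) ∧
    (1 ≤ n →
      2 ^ (n - 1) ≤ (Finset.univ.filter (fun I : Fin n → Bool => f I = true)).card) := by
  have hdual : ∀ I : Fin n → Bool, f I = false → f (fun i => !(I i)) = true := by
    intro I hI
    by_contra hne
    have hJ : f (fun i => !(I i)) = false := by simpa using hne
    obtain ⟨i, hi⟩ := hsep {I, fun i => !(I i)} Finset.card_le_two (by simp [hI, hJ])
    have hIi := hi I (by simp)
    have hJi := hi (fun i => !(I i)) (by simp)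
    simp [hIi] at hJi
  refine ⟨hdual, fun hn => ?_⟩
  have hle : (Finset.univ.filter (fun I : Fin n → Bool => ¬ f I = true)).card ≤
      (Finset.univ.filter (fun I : Fin n → Bool => f I = true)).card := by
    refine Finset.card_le_card_of_injOn (fun I i => !(I i)) (fun I hI => ?_) ?_
    · simpa using hdual I (by simpa using hI)
    · intro I _ J _ h
      funext i
      simpa using congrFun h i
  have hsum := Finset.card_filter_add_card_filter_not
    (s := (Finset.univ : Finset (Fin n → Bool))) (fun I => f I = true)
  have hcard : (Finset.univ : Finset (Fin n → Bool)).card = 2 * 2 ^ (n - 1) := by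
    rw [← pow_succ', Nat.sub_add_cancel hn]
    simp
  omega
end

section
/- Let V be any type and F : (V → Bool) → Bool. If {s, t} and {s', t'} are two dominant pairs for F (with s ≠ t and s' ≠ t'), then {s, t} ∩ {s', t'} ≠ ∅. -/
/-- Two dominant pairs for the same Boolean function intersect. -/
theorem stmt_2 (V : Type) (F : (V → Bool) → Bool) (s t s' t' : V)
    (hst : s ≠ t) (hst' : s' ≠ t')
    (hdom1 : ∀ I : V → Bool, I s = I t → F I = I s)
    (hdom2 : ∀ I : V → Bool, I s' = I t' → F I = I s') :
    ({s, t} : Set V) ∩ {s', t'} ≠ ∅ := by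
  classical
  intro h
  have hdisj : ∀ v, v = s ∨ v = t → ¬(v = s' ∨ v = t') := fun v hv hv' =>
    Set.eq_empty_iff_forall_notMem.mp h v ⟨hv, hv'⟩
  let I : V → Bool := fun v => decide (v = s ∨ v = t)
  have hs' : I s' = false := decide_eq_false fun hv => hdisj s' hv (Or.inl rfl)
  have ht' : I t' = false := decide_eq_false fun hv => hdisj t' hv (Or.inr rfl)
  have h1 : F I = true := by simpa [I] using hdom1 I (by simp [I])
  have h2 : F I = false := (hdom2 I (hs'.trans ht'.symm)).trans hs'
  exact Bool.false_ne_true (h2.symm.trans h1)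
end

section
/- Let C : (Fin n → Bool) → Bool → Bool → Bool, and define the Boolean function C' on the variable set consisting of Fin n together with two additional variables u and v by C'(I, a, b) = maj(a, C I a b, b), where a and b are the values assigned to u and v. Let f : (Fin n → Bool) → Bool be given by f I = C I true false. Assume that there is no coordinate i such that every satisfying assignment I of f has I i = true (f implies no variable), and no coordinate i such that every assignment I with I i = true satisfies f (no variable implies f). Then {u, v} is a dominant pair for C', and every dominant pair for C' is equal to {u, v}. -/
/-- The ternary majority function: true iff at least two arguments are true. -/
def maj (a b c : Bool) : Bool := (a && b) || (a && c) || (b && c)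

/-- A pair made of a `Fin n`-variable and one of `u`, `v` is not dominant, as witnessed by
assignments with `u = true` and `v = false`. -/
theorem not_dominant_inl_inr {n : ℕ} {C : (Fin n → Bool) → Bool → Bool → Bool}
    (h1 : ¬ ∃ i : Fin n, ∀ I : Fin n → Bool, C I true false = true → I i = true)
    (h2 : ¬ ∃ i : Fin n, ∀ I : Fin n → Bool, I i = true → C I true false = true)
    (i : Fin n) (b : Bool) :
    ¬ ∀ J : (Fin n ⊕ Bool) → Bool, J (Sum.inl i) = J (Sum.inr b) →
      maj (J (Sum.inr true))
          (C (fun i => J (Sum.inl i)) (J (Sum.inr true)) (J (Sum.inr false)))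
          (J (Sum.inr false)) = J (Sum.inl i) := by
  intro h
  cases b with
  | true =>
    refine h2 ⟨i, fun I hI => ?_⟩
    simpa [maj, hI] using h (Sum.elim I id)
  | false =>
    refine h1 ⟨i, fun I hI => ?_⟩
    by_contra hi
    simpa [maj, hI, hi] using h (Sum.elim I id)

/-- For `C' = maj(u, C(I,u,v), v)` over the variables `Fin n` plus two
extra variables `u = Sum.inr true` and `v = Sum.inr false`: if `f I = C I true false`
implies no variable and no variable implies `f`, then `{u,v}` is a dominant pair for
`C'` and it is the only dominant pair for `C'`. -/
theorem stmt_4 (n : ℕ) (C : (Fin n → Bool) → Bool → Bool → Bool)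
    (f : (Fin n → Bool) → Bool) (hf : ∀ I, f I = C I true false)
    (h1 : ¬ ∃ i : Fin n, ∀ I : Fin n → Bool, f I = true → I i = true)
    (h2 : ¬ ∃ i : Fin n, ∀ I : Fin n → Bool, I i = true → f I = true) :
    (∀ J : (Fin n ⊕ Bool) → Bool, J (Sum.inr true) = J (Sum.inr false) →
        maj (J (Sum.inr true))
            (C (fun i => J (Sum.inl i)) (J (Sum.inr true)) (J (Sum.inr false)))
            (J (Sum.inr false)) = J (Sum.inr true)) ∧
    (∀ s t : Fin n ⊕ Bool, s ≠ t →
        (∀ J : (Fin n ⊕ Bool) → Bool, J s = J t →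
          maj (J (Sum.inr true))
              (C (fun i => J (Sum.inl i)) (J (Sum.inr true)) (J (Sum.inr false)))
              (J (Sum.inr false)) = J s) →
        ({s, t} : Set (Fin n ⊕ Bool)) = {Sum.inr true, Sum.inr false}) := by
  obtain rfl : f = fun I => C I true false := funext hf
  refine ⟨fun J h => ?_, fun s t hst h => ?_⟩
  · rw [h]
    cases J (Sum.inr false) <;> simp [maj]
  · rcases s with i | a <;> rcases t with j | b
    · simpa [maj] using h (Sum.elim (fun _ => false) fun _ => true) rfl
    · exact (not_dominant_inl_inr h1 h2 i b h).elim
    · exact (not_dominant_inl_inr h1 h2 j a fun J hJ => (h J hJ.symm).trans hJ.symm).elim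
    · cases a <;> cases b <;> simp_all [Set.pair_comm]
end

section
/- Let g : (Fin n → Bool) → (Fin n → Bool) → Bool be monotone, i.e., if a ≤ a' and b ≤ b' pointwise (with false ≤ true) then g a b ≤ g a' b'. Define c₁ a b = true iff for every i, a i = true or b i = true, and define c₂ a b = c₁ a b && g a b. Then the following are equivalent: (i) g I Ī = true for every assignment I (where Ī i = !(I i)); (ii) c₁ and c₂ are equal as functions; (iii) the number of satisfying assignments (pairs (a,b)) of c₁ equals that of c₂. -/
/-- For monotone `g`, with `c₁ a b = true` iff every coordinate has
`a i = true` or `b i = true`, and `c₂ a b = c₁ a b && g a b`, the following are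
equivalent: (i) `g I Ī = true` for all `I`; (ii) `c₁ = c₂`; (iii) `c₁` and `c₂`
have the same number of satisfying assignment pairs. -/
theorem stmt_6 (n : ℕ) (g : (Fin n → Bool) → (Fin n → Bool) → Bool)
    (hmono : ∀ a a' b b' : Fin n → Bool,
      (∀ i, a i ≤ a' i) → (∀ i, b i ≤ b' i) → g a b ≤ g a' b')
    (c₁ c₂ : (Fin n → Bool) → (Fin n → Bool) → Bool)
    (hc₁ : ∀ a b, c₁ a b = true ↔ ∀ i, a i = true ∨ b i = true)
    (hc₂ : ∀ a b, c₂ a b = (c₁ a b && g a b)) :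
    ((∀ I : Fin n → Bool, g I (fun i => !(I i)) = true) ↔ c₁ = c₂) ∧
    ((c₁ = c₂) ↔
      (Finset.univ.filter
          (fun p : (Fin n → Bool) × (Fin n → Bool) => c₁ p.1 p.2 = true)).card =
      (Finset.univ.filter
          (fun p : (Fin n → Bool) × (Fin n → Bool) => c₂ p.1 p.2 = true)).card) := by
  have eq_of_imp (h : ∀ a b, c₁ a b = true → g a b = true) : c₁ = c₂ := by
    funext a b
    rw [hc₂]
    cases hab : c₁ a b
    · rfl
    · simp [h a b hab]
  refine ⟨⟨fun h => eq_of_imp fun a b hab => ?_, fun h I => ?_⟩, fun h => by rw [h],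
    fun h => eq_of_imp fun a b hab => ?_⟩
  · refine Bool.eq_true_of_true_le ((h a).symm.le.trans
      (hmono _ _ _ _ (fun _ => le_rfl) fun i => ?_))
    rcases (hc₁ a b).1 hab i with hi | hi <;> simp [hi, Bool.le_true]
  · have hI : c₁ I (fun i => !(I i)) = true := (hc₁ _ _).2 fun i => by cases I i <;> simp
    have hI₂ := hI
    rw [h, hc₂, hI] at hI₂
    simpa using hI₂
  · have hsub : Finset.univ.filter
          (fun p : (Fin n → Bool) × (Fin n → Bool) => c₂ p.1 p.2 = true) ⊆
        Finset.univ.filter (fun p => c₁ p.1 p.2 = true) :=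
      Finset.monotone_filter_right _ fun p _ hp => by
        rw [hc₂, Bool.and_eq_true] at hp
        exact hp.1
    have hmem : (a, b) ∈ Finset.univ.filter
        (fun p : (Fin n → Bool) × (Fin n → Bool) => c₂ p.1 p.2 = true) := by
      rw [Finset.eq_of_subset_of_card_le hsub h.le]
      simpa using hab
    have hab₂ : c₂ a b = true := (Finset.mem_filter.1 hmem).2
    rw [hc₂, Bool.and_eq_true] at hab₂
    exact hab₂.2
end

section
/- Let f : (Fin n → Bool) → Bool be monotone and let i : Fin n. Then the variable i is frozen in f if and only if f evaluates to true on the all-true assignment and f evaluates to false on the assignment flipᵢ that is false at i and true at all other coordinates. -/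
/-- For monotone `f`, the variable `i` is frozen in `f` iff `f`
is true on the all-true assignment and false on the assignment that is false
exactly at `i`. -/
theorem stmt_10 (n : ℕ) (f : (Fin n → Bool) → Bool)
    (hmono : ∀ I J : Fin n → Bool, (∀ j, I j ≤ J j) → f I ≤ f J) (i : Fin n) :
    ((∃ I : Fin n → Bool, f I = true) ∧
        ∃ c : Bool, ∀ I : Fin n → Bool, f I = true → I i = c) ↔
    (f (fun _ => true) = true ∧ f (fun j => if j = i then false else true) = false) := by
  have up : ∀ I J : Fin n → Bool, (∀ j, I j ≤ J j) → f I = true → f J = true :=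
    fun I J hIJ hI => Bool.eq_true_of_true_le (hI ▸ hmono I J hIJ)
  constructor
  · rintro ⟨⟨I, hI⟩, c, hc⟩
    have htop : f (fun _ => true) = true := up I _ (fun j => Bool.le_true (I j)) hI
    refine ⟨htop, Bool.eq_false_iff.mpr fun hflip => ?_⟩
    have hfalse := hc _ hflip
    rw [← hc _ htop] at hfalse
    simp at hfalse
  · rintro ⟨htop, hflip⟩
    refine ⟨⟨_, htop⟩, true, fun I hI => ?_⟩
    by_contra hi
    refine Bool.eq_false_iff.mp hflip (up I _ (fun j => ?_) hI)
    by_cases hj : j = i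
    · subst hj
      simp [hi]
    · simp [hj, Bool.le_true]
end

section
/- Let S, T be finite subsets of Fin n and a₀, b₀ : Bool. Define f I = a₀ || (∃ i ∈ S, I i = true) and g I = b₀ || (∃ i ∈ T, I i = true). Then f is isomorphic to g if and only if either a₀ = true and b₀ = true, or a₀ = b₀ and S and T have the same cardinality. -/
/-- Finsets of equal cardinality in a finite type are related by a permutation. -/
theorem exists_perm_map_eq_of_card_eq {α : Type*} [Finite α] {S T : Finset α}
    (h : S.card = T.card) : ∃ π : Equiv.Perm α, T.map π.toEmbedding = S := by
  classical
  have := Fintype.ofFinite α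
  let e : {x // x ∈ T} ≃ {x // x ∈ S} := Finset.equivOfCardEq h.symm
  refine ⟨e.extendSubtype, Finset.eq_of_subset_of_card_le ?_ (by simp [h])⟩
  intro x hx
  obtain ⟨i, hi, rfl⟩ := Finset.mem_map.1 hx
  exact e.extendSubtype_mem i hi

/-- `f I = a₀ ∨ (∃ i ∈ S, I i)` is isomorphic to
`g I = b₀ ∨ (∃ i ∈ T, I i)` iff either `a₀ = b₀ = true`, or `a₀ = b₀` and
`|S| = |T|`. -/
theorem stmt_14 (n : ℕ) (S T : Finset (Fin n)) (a₀ b₀ : Bool)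
    (f g : (Fin n → Bool) → Bool)
    (hf : ∀ I : Fin n → Bool, f I = (a₀ || decide (∃ i ∈ S, I i = true)))
    (hg : ∀ I : Fin n → Bool, g I = (b₀ || decide (∃ i ∈ T, I i = true))) :
    (∃ π : Equiv.Perm (Fin n), ∀ I : Fin n → Bool, f I = g (I ∘ π)) ↔
    ((a₀ = true ∧ b₀ = true) ∨ (a₀ = b₀ ∧ S.card = T.card)) := by
  constructor
  · rintro ⟨π, h⟩
    simp only [hf, hg, Function.comp_apply] at h
    obtain rfl : a₀ = b₀ := by simpa using h fun _ => false
    cases a₀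
    · refine Or.inr ⟨rfl, ?_⟩
      have hST : S = T.map π.toEmbedding := by
        ext j
        simpa [-Finset.mem_map_equiv, Finset.mem_map] using h fun i => decide (i = j)
      rw [hST, Finset.card_map]
    · exact Or.inl ⟨rfl, rfl⟩
  · rintro (⟨rfl, rfl⟩ | ⟨rfl, h⟩)
    · exact ⟨1, fun I => by simp [hf, hg]⟩
    · obtain ⟨π, rfl⟩ := exists_perm_map_eq_of_card_eq h
      exact ⟨π, fun I => by simp [hf, hg, -Finset.mem_map_equiv, Finset.mem_map]⟩
end

section
/- For every k ≥ 1, the (k+1)-ary threshold function t_k, defined by t_k(a₁, …, a_{k+1}) = true iff at least k of the arguments are true, is 1-separating of degree k but not 1-separating of degree k + 1. -/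
/-- For `k ≥ 1`, the `(k+1)`-ary threshold function `t_k` (true iff
at least `k` arguments are true) is 1-separating of degree `k` but not of degree
`k + 1`. -/
theorem stmt_17 (k : ℕ) (hk : 1 ≤ k) (t : (Fin (k + 1) → Bool) → Bool)
    (ht : ∀ a : Fin (k + 1) → Bool,
      t a = true ↔ k ≤ (Finset.univ.filter (fun i => a i = true)).card) :
    (∀ A : Finset (Fin (k + 1) → Bool), A.card ≤ k →
      (∀ a ∈ A, t a = true) → ∃ i : Fin (k + 1), ∀ a ∈ A, a i = true) ∧
    ¬(∀ A : Finset (Fin (k + 1) → Bool), A.card ≤ k + 1 →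
      (∀ a ∈ A, t a = true) → ∃ i : Fin (k + 1), ∀ a ∈ A, a i = true) := by
  constructor
  · intro A hA hAt
    by_contra! h
    choose f hfA hf using h
    obtain ⟨i, -, j, -, hij, hfij⟩ := Finset.exists_ne_map_eq_of_card_lt_of_maps_to
      (s := Finset.univ) (t := A) (f := f) (by simpa using Nat.lt_succ_of_le hA)
      (fun i _ => hfA i)
    have hcard := (ht _).1 (hAt _ (hfA i))
    have hsub : Finset.univ.filter (fun l => f i l = true) ⊆ Finset.univ \ {i, j} := by
      intro l hl
      have hl' : f i l = true := by simpa using hl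
      simp only [Finset.mem_sdiff, Finset.mem_univ, true_and, Finset.mem_insert,
        Finset.mem_singleton, not_or]
      refine ⟨?_, ?_⟩
      · rintro rfl
        exact hf l hl'
      · rintro rfl
        exact hf l (hfij ▸ hl')
    have hle := Finset.card_le_card hsub
    rw [Finset.card_sdiff_of_subset (Finset.subset_univ _), Finset.card_pair hij,
      Finset.card_univ, Fintype.card_fin] at hle
    omega
  · intro h
    obtain ⟨i, hi⟩ := h (Finset.univ.image fun i j => decide (j ≠ i))
      (Finset.card_image_le.trans (by simp)) (by
        intro a ha
        obtain ⟨i, -, rfl⟩ := Finset.mem_image.1 ha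
        simp [ht, Finset.filter_ne'])
    simpa using hi _ (Finset.mem_image_of_mem _ (Finset.mem_univ i))
end

section
/- Let k ≥ 2 and let f : (Fin n → Bool) → Bool satisfy f(all-true) = true. Define G over the n + k variables (I, J) with I : Fin n → Bool and J : Fin k → Bool by: G(I, J) = T && ((∀ j, J j = true) || ¬(∀ i, I i = true)), where T = true iff at least k of the k + 1 values f I, J 1, …, J k are true. Then G has a frozen variable if and only if f has no satisfying assignment other than the all-true assignment. -/
/-- For `k ≥ 2` and `f` with `f(all-true) = true`, the function
`G(I,J) = T ∧ ((∀ j, J j) ∨ ¬(∀ i, I i))` where `T` is true iff at least `k` of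
the `k+1` values `f I, J 1, …, J k` are true, has a frozen variable iff `f` has
no satisfying assignment other than the all-true assignment. -/
theorem stmt_19 (k n : ℕ) (hk : 2 ≤ k) (f : (Fin n → Bool) → Bool)
    (hftop : f (fun _ => true) = true)
    (G : (Fin n ⊕ Fin k → Bool) → Bool)
    (hG : ∀ P : Fin n ⊕ Fin k → Bool,
      G P = (decide (k ≤
               (if f (fun i => P (Sum.inl i)) then 1 else 0) +
               (Finset.univ.filter (fun j : Fin k => P (Sum.inr j) = true)).card) &&
             (decide (∀ j : Fin k, P (Sum.inr j) = true) ||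
              !decide (∀ i : Fin n, P (Sum.inl i) = true)))) :
    (∃ v : Fin n ⊕ Fin k,
        (∃ P, G P = true) ∧ ∃ c : Bool, ∀ P, G P = true → P v = c) ↔
    (∀ I : Fin n → Bool, f I = true → ∀ i : Fin n, I i = true) := by
  have hall : ∀ P : Fin n ⊕ Fin k → Bool, (∀ j, P (Sum.inr j) = true) → G P = true := by
    intro P hP
    simp [hG, hP]
  constructor
  · rintro ⟨v, -, c, hc⟩ I hI i
    cases v with
    | inl m =>
      have h := hc (Sum.elim (fun _ => !c) fun _ => true) (hall _ fun _ => rfl)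
      simp at h
    | inr j =>
      have hct : true = c := hc (fun _ => true) (hall _ fun _ => rfl)
      by_contra hi
      have hcard : (Finset.univ.filter fun m : Fin k => m ≠ j).card = k - 1 := by
        simp [Finset.filter_ne']
      have hsat : G (Sum.elim I fun m => decide (m ≠ j)) = true := by
        rw [hG]
        simp only [Sum.elim_inl, Sum.elim_inr, hI, if_true, Bool.and_eq_true,
          Bool.or_eq_true, Bool.not_eq_true', decide_eq_true_eq]
        exact ⟨by omega, Or.inr (decide_eq_false fun h => hi (h i))⟩
      have h := hc _ hsat
      simp [← hct] at h
  · intro hf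
    refine ⟨Sum.inr ⟨0, by omega⟩, ⟨fun _ => true, hall _ fun _ => rfl⟩, true, fun P hP => ?_⟩
    rw [hG] at hP
    simp only [Bool.and_eq_true, Bool.or_eq_true, Bool.not_eq_true', decide_eq_true_eq,
      decide_eq_false_iff_not] at hP
    obtain ⟨hcount, hJ | hI⟩ := hP
    · exact hJ _
    · rw [if_neg fun h => hI (hf _ h), zero_add] at hcount
      have hle := Finset.card_filter_le Finset.univ fun j : Fin k => P (Sum.inr j) = true
      have heq := le_antisymm hle (by simpa using hcount)
      exact Finset.card_filter_eq_iff.mp heq _ (Finset.mem_univ _)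
end
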